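/- Let W be a nonempty finite type, c : W → ℝ with 0 ≤ c w for all w and 0 < c w₀ for some w₀, and let f, g : W → ℝ satisfy P_g w = Q_f w for all w ∈ W (the exact posterior update). Then Real.log (L(g)) - Real.log (L(f)) ≥ KL(P_g ‖ P_f). -/

import Mathlib

/-- The softmax (Gibbs) distribution associated with logits `f`. -/
noncomputable def softmax {W : Type*} [Fintype W] (f : W → ℝ) (w : W) : ℝ :=
  Real.exp (f w) / ∑ w', Real.exp (f w')

/-- The log-partition function of the logits `f`. -/
noncomputable def logPartition {W : Type*} [Fintype W] (f : W → ℝ) : ℝ :=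
  Real.log (∑ w, Real.exp (f w))

/-- Kullback–Leibler divergence between finitely supported densities `p` and `q`
(with the convention `0 * log 0 = 0`, which holds definitionally in `ℝ`). -/
noncomputable def KLdiv {W : Type*} [Fintype W] (p q : W → ℝ) : ℝ :=
  ∑ w, p w * Real.log (p w / q w)

/-- Marginal likelihood: the `c`-weighted total mass of the softmax distribution of `f`. -/
noncomputable def margL {W : Type*} [Fintype W] (c f : W → ℝ) : ℝ :=
  ∑ w, c w * softmax f w

/-- Posterior distribution obtained by reweighting the softmax distribution of `f`
by the evaluation weights `c` and normalizing. -/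
noncomputable def post {W : Type*} [Fintype W] (c f : W → ℝ) (w : W) : ℝ :=
  c w * softmax f w / margL c f

theorem softmax_pos {W : Type*} [Fintype W] [Nonempty W] (f : W → ℝ) (w : W) :
    0 < softmax f w :=
  div_pos (Real.exp_pos _) (Finset.sum_pos (fun _ _ => Real.exp_pos _) Finset.univ_nonempty)

theorem sum_softmax {W : Type*} [Fintype W] [Nonempty W] (f : W → ℝ) :
    ∑ w, softmax f w = 1 := by
  have h : 0 < ∑ w, Real.exp (f w) :=
    Finset.sum_pos (fun _ _ => Real.exp_pos _) Finset.univ_nonempty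
  simp only [softmax]
  rw [← Finset.sum_div, div_self h.ne']

theorem margL_pos {W : Type*} [Fintype W] [Nonempty W] {c : W → ℝ} (hc : ∀ w, 0 ≤ c w)
    {w₀ : W} (hc₀ : 0 < c w₀) (f : W → ℝ) : 0 < margL c f :=
  Finset.sum_pos' (fun w _ => mul_nonneg (hc w) (softmax_pos f w).le)
    ⟨w₀, Finset.mem_univ _, mul_pos hc₀ (softmax_pos f w₀)⟩

/-- Jensen's inequality for the logarithm under a softmax distribution. -/
theorem sum_softmax_mul_log_le {W : Type*} [Fintype W] [Nonempty W] {c : W → ℝ}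
    (hc : ∀ w, 0 < c w) (f : W → ℝ) :
    ∑ w, softmax f w * Real.log (c w) ≤ Real.log (margL c f) := by
  have h := strictConcaveOn_log_Ioi.concaveOn.le_map_sum (t := Finset.univ) (p := c)
    (fun w _ => (softmax_pos f w).le) (sum_softmax f) (fun w _ => hc w)
  simpa only [smul_eq_mul, margL, mul_comm (c _)] using h

/-- Per-iteration inequality for the exact posterior update: if `P_g = Q_f`, then the
marginal log-likelihood increases by at least `KL(P_g ‖ P_f)`. -/
theorem log_margL_gain_ge_klDiv {W : Type*} [Fintype W] [Nonempty W]
    (c : W → ℝ) (hc : ∀ w, 0 ≤ c w) (w₀ : W) (hc₀ : 0 < c w₀) (f g : W → ℝ)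
    (hupd : ∀ w, softmax g w = post c f w) :
    Real.log (margL c g) - Real.log (margL c f) ≥ KLdiv (softmax g) (softmax f) := by
  have hL := margL_pos hc hc₀ f
  have hcpos : ∀ w, 0 < c w := fun w => (hc w).lt_of_ne' fun h0 =>
    (softmax_pos g w).ne' (by simp [hupd w, post, h0])
  have hlog : ∀ w, Real.log (softmax g w / softmax f w) =
      Real.log (c w) - Real.log (margL c f) := fun w => by
    have hf := (softmax_pos f w).ne'
    rw [← Real.log_div (hcpos w).ne' hL.ne', hupd w, post]
    congr 1
    field_simp
  have hKL : KLdiv (softmax g) (softmax f) =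
      ∑ w, softmax g w * Real.log (c w) - Real.log (margL c f) := by
    simp only [KLdiv, hlog, mul_sub, Finset.sum_sub_distrib, ← Finset.sum_mul, sum_softmax,
      one_mul]
  rw [hKL, ge_iff_le]
  exact sub_le_sub_right (sum_softmax_mul_log_le hcpos g) _
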